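/- The right ℤ[F]-module C(D, ℤ) of continuous functions D → ℤ is finitely generated: there exist finitely many continuous functions σ₁, …, σ_k : D → ℤ such that every continuous function D → ℤ is a finite ℤ-linear combination of F-translates σ_j · g of the σ_j. -/

import Mathlib

open scoped BigOperators

namespace DecompPaper

variable (B : Type) [DecidableEq B]

/-- The set of letters `B ⊔ B⁻¹` carries the discrete topology. -/
instance : TopologicalSpace (B × Bool) := ⊥

/-- The Gromov boundary `∂F` of the free group on `B`: the space of infinite reduced
words, i.e. sequences of letters with no cancelling adjacent pair, topologized as a
subspace of the product of discrete spaces. -/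
abbrev Boundary : Type :=
  {s : ℕ → B × Bool // ∀ k, s (k + 1) ≠ ((s k).1, !(s k).2)}

/-- The prefix of length `m` of an infinite reduced word, as an element of the free group. -/
def prefixOf (ξ : Boundary B) (m : ℕ) : FreeGroup B :=
  FreeGroup.mk (List.ofFn fun i : Fin m => ξ.1 i)

/-- Adjacency in the Cayley graph `T` of the free group with respect to `B`. -/
def Adj (g h : FreeGroup B) : Prop :=
  ∃ x : B × Bool, h = g * FreeGroup.mk [x]

/-- A set of vertices of `T` is a subtree iff any two of its vertices are joined by a
path in the Cayley graph staying inside the set. -/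
def IsSubtree (X : Set (FreeGroup B)) : Prop :=
  ∀ g ∈ X, ∀ h ∈ X, Relation.ReflTransGen (fun a b => Adj B a b ∧ b ∈ X) g h

/-- `C` is a connected component of `T ∖ X`. -/
def IsComponentOf (X C : Set (FreeGroup B)) : Prop :=
  ∃ v, v ∉ X ∧
    C = {u | Relation.ReflTransGen (fun a b => Adj B a b ∧ a ∉ X ∧ b ∉ X) v u}

/-- `∂C`: the set of boundary points all of whose sufficiently long prefixes lie in `C`. -/
def boundaryOf (C : Set (FreeGroup B)) : Set (Boundary B) :=
  {ξ | ∃ m, ∀ k, m ≤ k → prefixOf B ξ k ∈ C}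

/-- The sequence `a` of group elements converges to the boundary point `ξ`:
every prefix of `ξ` is eventually an initial segment of the reduced word of `a k`. -/
def TendstoBoundary (a : ℕ → FreeGroup B) (ξ : Boundary B) : Prop :=
  ∀ m : ℕ, ∃ K, ∀ k, K ≤ k → (List.ofFn fun i : Fin m => ξ.1 i) <+: (a k).toWord

/-- `{ξ, η}` is a line of the line pattern generated by the words `w i`: for some
`g` and `i`, `ξ` and `η` are the limits of `g * (w i) ^ k` as `k → +∞` and `k → -∞`
(in one of the two orders). -/
def IsLine {r : ℕ} (w : Fin r → FreeGroup B) (ξ η : Boundary B) : Prop :=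
  ∃ (g : FreeGroup B) (i : Fin r),
    (TendstoBoundary B (fun k => g * w i ^ k) ξ ∧
       TendstoBoundary B (fun k => g * (w i)⁻¹ ^ k) η) ∨
    (TendstoBoundary B (fun k => g * w i ^ k) η ∧
       TendstoBoundary B (fun k => g * (w i)⁻¹ ^ k) ξ)

/-- Malnormality of the family of cyclic subgroups `⟨w i⟩`. -/
def Malnormal {r : ℕ} (w : Fin r → FreeGroup B) : Prop :=
  ∀ (g : FreeGroup B) (i j : Fin r),
    (∃ x : FreeGroup B, x ∈ Subgroup.zpowers (w i) ∧ x ≠ 1 ∧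
        g * x * g⁻¹ ∈ Subgroup.zpowers (w j)) →
      i = j ∧ g ∈ Subgroup.zpowers (w i)

/-- The decomposition space `D`: the quotient of `∂F` by the smallest equivalence
relation identifying the two endpoints of each line, with the quotient topology. -/
abbrev DSpace {r : ℕ} (w : Fin r → FreeGroup B) : Type :=
  Quot (IsLine B w)

/-- The quotient projection `q : ∂F → D`. -/
def qmap {r : ℕ} (w : Fin r → FreeGroup B) : Boundary B → DSpace B w :=
  Quot.mk _

/-- The geodesic of the line with endpoints `ξ` and `η`: all prefixes of `ξ` or of `η`
of length at least the length of their longest common initial segment. -/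
def lineGeodesic (ξ η : Boundary B) : Set (FreeGroup B) :=
  {g | ∃ k : ℕ, (g = prefixOf B ξ k ∨ g = prefixOf B η k) ∧ ∃ i ≤ k, ξ.1 i ≠ η.1 i}

/-- The line with endpoints `ξ, η` passes through the subtree `X`. -/
def PassesThrough (ξ η : Boundary B) (X : Set (FreeGroup B)) : Prop :=
  ∃ g ∈ X, g ∈ lineGeodesic B ξ η

/-- A function `σ : D → ℤ` is supported on the subtree `X` if `σ ∘ q` is constant on
`∂C` for every connected component `C` of `T ∖ X`. -/
def SupportedOn {r : ℕ} (w : Fin r → FreeGroup B) (σ : DSpace B w → ℤ)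
    (X : Set (FreeGroup B)) : Prop :=
  ∀ C : Set (FreeGroup B), IsComponentOf B X C →
    ∀ ξ, ξ ∈ boundaryOf B C → ∀ η, η ∈ boundaryOf B C →
      σ (qmap B w ξ) = σ (qmap B w η)

/-- Prepending a letter to an infinite reduced word, cancelling if necessary. -/
def consB (x : B × Bool) (ξ : Boundary B) : Boundary B :=
  if h : ξ.1 0 = (x.1, !x.2) then
    ⟨fun k => ξ.1 (k + 1), fun k => ξ.2 (k + 1)⟩
  else
    ⟨fun k => Nat.rec x (fun j _ => ξ.1 j) k, by
      intro k
      cases k with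
      | zero => exact h
      | succ j => exact ξ.2 j⟩

/-- The action of the free group on its boundary: left multiplication followed by
reduction. -/
def actB (g : FreeGroup B) (ξ : Boundary B) : Boundary B :=
  g.toWord.foldr (consB B) ξ

/-- The induced action of the free group on the decomposition space. -/
noncomputable def actD {r : ℕ} (w : Fin r → FreeGroup B) (g : FreeGroup B)
    (x : DSpace B w) : DSpace B w :=
  qmap B w (actB B g (Quot.out x))

/-- The map `p : (ℤ[F])^k → C(D, ℤ)` of right `ℤ[F]`-modules determined by generators
`σ j`, where an element of the free module `(ℤ[F])^k` is recorded as a finitely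
supported function `(Fin k × F) →₀ ℤ` and `e_j · g` is sent to `σ j · g`. -/
noncomputable def pMap {r : ℕ} (w : Fin r → FreeGroup B) {k : ℕ}
    (σ : Fin k → DSpace B w → ℤ) (x : (Fin k × FreeGroup B) →₀ ℤ) :
    DSpace B w → ℤ :=
  fun d => x.sum fun p n => n * σ p.1 (actD B w p.2 d)

/-- Right translation by `g` on the free module `(ℤ[F])^k`, sending `e_j · h` to
`e_j · (h * g)`. -/
noncomputable def fsTranslate {k : ℕ} (y : (Fin k × FreeGroup B) →₀ ℤ)
    (g : FreeGroup B) : (Fin k × FreeGroup B) →₀ ℤ :=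
  Finsupp.mapDomain (fun p => (p.1, p.2 * g)) y

/-- The convex hull of a set of vertices of `T`: the smallest subtree containing it. -/
def hull (S : Set (FreeGroup B)) : Set (FreeGroup B) :=
  ⋂₀ {Y : Set (FreeGroup B) | IsSubtree B Y ∧ S ⊆ Y}

/-- The support of an element of the free module `(ℤ[F])^k`, relative to supports
`X j` of the generators: the convex hull of the union of the sets `g⁻¹ • X j` over
the pairs `(j, g)` appearing with nonzero coefficient. -/
def fsSupport {k : ℕ} (X : Fin k → Set (FreeGroup B))
    (x : (Fin k × FreeGroup B) →₀ ℤ) : Set (FreeGroup B) :=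
  hull B (⋃ p ∈ x.support, (fun v => p.2⁻¹ * v) '' X p.1)

/-- Antisymmetry of a `1`-cochain on oriented lines. -/
def Antisym {r : ℕ} (w : Fin r → FreeGroup B)
    (f : Boundary B → Boundary B → ℤ) : Prop :=
  ∀ ξ η, IsLine B w ξ η → f η ξ = -f ξ η

/-- A `1`-cochain is supported on the subtree `X`: it vanishes on lines not passing
through `X`, and depends only on the pair of components of `T ∖ X` containing the two
endpoints. -/
def SupportedOn1 {r : ℕ} (w : Fin r → FreeGroup B)
    (f : Boundary B → Boundary B → ℤ) (X : Set (FreeGroup B)) : Prop :=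
  (∀ ξ η, IsLine B w ξ η → ¬PassesThrough B ξ η X → f ξ η = 0) ∧
  (∀ C C' : Set (FreeGroup B), IsComponentOf B X C → IsComponentOf B X C' → C ≠ C' →
    ∀ ξ ξ' η η', IsLine B w ξ η → IsLine B w ξ' η' →
      ξ ∈ boundaryOf B C → ξ' ∈ boundaryOf B C →
      η ∈ boundaryOf B C' → η' ∈ boundaryOf B C' →
      f ξ η = f ξ' η')

/-- Membership in `C¹`: an antisymmetric integer-valued function on oriented lines
supported on at least one finite nonempty subtree of `T`. -/
def MemC1 {r : ℕ} (w : Fin r → FreeGroup B)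
    (f : Boundary B → Boundary B → ℤ) : Prop :=
  Antisym B w f ∧
    ∃ X : Set (FreeGroup B), X.Finite ∧ X.Nonempty ∧ IsSubtree B X ∧
      SupportedOn1 B w f X

/-- The ball of radius `R` about a set `Y` of vertices of `T` (word metric). -/
def ballAbout (Y : Set (FreeGroup B)) (R : ℕ) : Set (FreeGroup B) :=
  {g | ∃ y ∈ Y, (y⁻¹ * g).toWord.length ≤ R}

/-- The map `p : (ℤ[F])^k → C¹` of right `ℤ[F]`-modules determined by generators
`f j`, sending `e_j · g` to `f j · g`. -/
noncomputable def pC1 {k : ℕ} (f : Fin k → Boundary B → Boundary B → ℤ)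
    (x : (Fin k × FreeGroup B) →₀ ℤ) : Boundary B → Boundary B → ℤ :=
  fun ξ η => x.sum fun p n => n * f p.1 (actB B p.2 ξ) (actB B p.2 η)

/-- `σ : ∂F → ℤ` is constant on `∂C` for every connected component `C` of `T ∖ X`. -/
def ConstOnComponents (X : Set (FreeGroup B)) (σ : Boundary B → ℤ) : Prop :=
  ∀ C : Set (FreeGroup B), IsComponentOf B X C →
    ∀ ξ, ξ ∈ boundaryOf B C → ∀ η, η ∈ boundaryOf B C → σ ξ = σ η

/-- The shadow `S(g) ⊆ ∂F` of a nontrivial group element `g`: the boundary points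
having the reduced word of `g` as an initial segment. -/
def shadow (g : FreeGroup B) : Set (Boundary B) :=
  {ξ | prefixOf B ξ g.toWord.length = g}

end DecompPaper

namespace DecompPaper

section FreeGroupWords

variable {B : Type}

/-- The inverse of a letter. -/
def invLetter (x : B × Bool) : B × Bool := (x.1, !x.2)

lemma invLetter_invLetter (x : B × Bool) : invLetter (invLetter x) = x := by
  simp [invLetter]

lemma mk_invLetter (x : B × Bool) :
    FreeGroup.mk [invLetter x] = (FreeGroup.mk [x])⁻¹ := by
  simp [FreeGroup.inv_mk, FreeGroup.invRev, invLetter]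

variable [DecidableEq B]

lemma toWord_letter_mul (x : B × Bool) (g : FreeGroup B) :
    (FreeGroup.mk [x] * g).toWord = FreeGroup.reduce (x :: g.toWord) := by
  rw [FreeGroup.toWord_mul, FreeGroup.toWord_mk, FreeGroup.reduce_singleton,
    List.singleton_append]

lemma toWord_letter_mul_of_head?_ne {x : B × Bool} {g : FreeGroup B}
    (h : g.toWord.head? ≠ some (invLetter x)) :
    (FreeGroup.mk [x] * g).toWord = x :: g.toWord := by
  rw [toWord_letter_mul, FreeGroup.reduce.cons, FreeGroup.reduce_toWord]
  rcases hg : g.toWord with _ | ⟨y, l⟩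
  · rfl
  · rw [hg] at h
    have : ¬(x.1 = y.1 ∧ x.2 = !y.2) := by
      rintro ⟨h1, h2⟩
      exact h (by simp [invLetter, h1, h2])
    simp [this]

lemma toWord_eq_cons_of_head?_eq {x : B × Bool} {g : FreeGroup B}
    (h : g.toWord.head? = some (invLetter x)) :
    g.toWord = invLetter x :: (FreeGroup.mk [x] * g).toWord := by
  rw [toWord_letter_mul, FreeGroup.reduce.cons, FreeGroup.reduce_toWord]
  rcases hg : g.toWord with _ | ⟨y, l⟩
  · simp [hg] at h
  · rw [hg] at h
    obtain rfl : y = invLetter x := by simpa using h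
    simp [invLetter]

lemma toWord_mul_letter (y : B × Bool) (g : FreeGroup B) :
    (g * FreeGroup.mk [y]).toWord = g.toWord ++ [y] ∨
      g.toWord = (g * FreeGroup.mk [y]).toWord ++ [invLetter y] := by
  have key : FreeGroup.mk [invLetter y] * g⁻¹ = (g * FreeGroup.mk [y])⁻¹ := by
    rw [mk_invLetter, mul_inv_rev]
  by_cases h : (g⁻¹).toWord.head? = some (invLetter (invLetter y))
  · right
    have h1 := toWord_eq_cons_of_head?_eq h
    rw [key, FreeGroup.toWord_inv, FreeGroup.toWord_inv] at h1
    have h2 := congrArg FreeGroup.invRev h1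
    rw [FreeGroup.invRev_invRev] at h2
    rw [h2]
    simp [FreeGroup.invRev, invLetter, Function.comp_def]
  · left
    have h1 := toWord_letter_mul_of_head?_ne h
    rw [key, FreeGroup.toWord_inv, FreeGroup.toWord_inv] at h1
    have h2 := congrArg FreeGroup.invRev h1
    rw [FreeGroup.invRev_invRev] at h2
    rw [h2]
    simp [FreeGroup.invRev, invLetter, Function.comp_def]

/-- An edge of the Cayley tree along which the first letter changes has the identity as
an endpoint. -/
lemma eq_one_or_of_head?_change {x y : B × Bool} {g : FreeGroup B}
    (h : ¬(g.toWord.head? = some x ↔ (g * FreeGroup.mk [y]).toWord.head? = some x)) :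
    g = 1 ∨ g * FreeGroup.mk [y] = 1 := by
  by_contra! hne
  have h1 : g.toWord ≠ [] := fun e => hne.1 (FreeGroup.toWord_eq_nil_iff.1 e)
  have h2 : (g * FreeGroup.mk [y]).toWord ≠ [] :=
    fun e => hne.2 (FreeGroup.toWord_eq_nil_iff.1 e)
  rcases toWord_mul_letter y g with e | e
  · rw [e, List.head?_append_of_ne_nil _ h1] at h
    exact h Iff.rfl
  · rw [e, List.head?_append_of_ne_nil _ h2] at h
    exact h Iff.rfl

/-- A path in the Cayley tree along which the first letter changes visits the identity. -/
lemma exists_prefix_mul_eq_one {x : B × Bool} (L : List (B × Bool)) (g : FreeGroup B)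
    (h : ¬(g.toWord.head? = some x ↔ (g * FreeGroup.mk L).toWord.head? = some x)) :
    ∃ p ∈ L.inits, g * FreeGroup.mk p = 1 := by
  induction L generalizing g with
  | nil =>
    rw [← FreeGroup.one_eq_mk, mul_one] at h
    exact absurd Iff.rfl h
  | cons y L ih =>
    have split (M : List (B × Bool)) :
        g * FreeGroup.mk (y :: M) = g * FreeGroup.mk [y] * FreeGroup.mk M := by
      rw [mul_assoc, FreeGroup.mul_mk, List.singleton_append]
    by_cases hy : g.toWord.head? = some x ↔ (g * FreeGroup.mk [y]).toWord.head? = some x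
    · rw [split, hy] at h
      obtain ⟨p, hp, e⟩ := ih _ h
      refine ⟨y :: p, ?_, by rw [split, e]⟩
      simpa using hp
    · rcases eq_one_or_of_head?_change hy with e | e
      · exact ⟨[], by simp, by rw [← FreeGroup.one_eq_mk, mul_one, e]⟩
      · exact ⟨[y], by simp, e⟩

end FreeGroupWords

section Action

variable {B : Type} [DecidableEq B]

lemma consB_of_eq {x : B × Bool} {ξ : Boundary B} (h : ξ.1 0 = invLetter x) (k : ℕ) :
    (consB B x ξ).1 k = ξ.1 (k + 1) := by
  have h' : ξ.1 0 = (x.1, !x.2) := h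
  simp [consB, h']

lemma consB_of_ne_zero {x : B × Bool} {ξ : Boundary B} (h : ξ.1 0 ≠ invLetter x) :
    (consB B x ξ).1 0 = x := by
  have h' : ¬ξ.1 0 = (x.1, !x.2) := h
  simp [consB, h']

lemma consB_of_ne_succ {x : B × Bool} {ξ : Boundary B} (h : ξ.1 0 ≠ invLetter x) (k : ℕ) :
    (consB B x ξ).1 (k + 1) = ξ.1 k := by
  have h' : ¬ξ.1 0 = (x.1, !x.2) := h
  simp [consB, h']

lemma consB_consB_invLetter (x : B × Bool) (ξ : Boundary B) :
    consB B x (consB B (invLetter x) ξ) = ξ := by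
  apply Subtype.ext
  funext k
  by_cases h : ξ.1 0 = invLetter (invLetter x)
  · have h0 : (consB B (invLetter x) ξ).1 0 ≠ invLetter x := by
      rw [consB_of_eq h]
      have := ξ.2 0
      rw [h, invLetter_invLetter] at this
      exact this
    cases k with
    | zero => rw [consB_of_ne_zero h0, h, invLetter_invLetter]
    | succ k => rw [consB_of_ne_succ h0, consB_of_eq h]
  · rw [consB_of_eq (consB_of_ne_zero h), consB_of_ne_succ h]

/-- Prepending a letter, as a permutation of the boundary. -/
def consPerm (x : B × Bool) : Equiv.Perm (Boundary B) where
  toFun := consB B x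
  invFun := consB B (invLetter x)
  left_inv ξ := by
    simpa only [invLetter_invLetter] using consB_consB_invLetter (invLetter x) ξ
  right_inv := consB_consB_invLetter x

lemma actB_eq_lift (g : FreeGroup B) (ξ : Boundary B) :
    actB B g ξ = FreeGroup.lift (fun b => consPerm (b, true)) g ξ := by
  have hlist (L : List (B × Bool)) :
      L.foldr (consB B) ξ
        = FreeGroup.lift (fun b => consPerm (b, true)) (FreeGroup.mk L) ξ := by
    rw [FreeGroup.lift_mk]
    induction L with
    | nil => rfl
    | cons x L ih =>
      rw [List.foldr_cons, ih, List.map_cons, List.prod_cons, Equiv.Perm.mul_apply]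
      rcases x with ⟨b, _ | _⟩ <;> rfl
  rw [actB, hlist, FreeGroup.mk_toWord]

lemma actB_mul (g h : FreeGroup B) (ξ : Boundary B) :
    actB B (g * h) ξ = actB B g (actB B h ξ) := by
  simp only [actB_eq_lift, map_mul, Equiv.Perm.mul_apply]

lemma actB_one (ξ : Boundary B) : actB B 1 ξ = ξ := by
  simp [actB]

lemma actB_letter (x : B × Bool) (ξ : Boundary B) :
    actB B (FreeGroup.mk [x]) ξ = consB B x ξ := by
  simp [actB, FreeGroup.toWord_mk]

end Action

section Lines

variable {B : Type} [DecidableEq B]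

lemma TendstoBoundary.head? {a : ℕ → FreeGroup B} {ξ : Boundary B}
    (h : TendstoBoundary B a ξ) :
    ∃ K, ∀ k, K ≤ k → (a k).toWord.head? = some (ξ.1 0) := by
  obtain ⟨K, hK⟩ := h 1
  refine ⟨K, fun k hk => ?_⟩
  obtain ⟨t, ht⟩ := hK k hk
  rw [← ht]
  simp

lemma TendstoBoundary.unique {a : ℕ → FreeGroup B} {ξ η : Boundary B}
    (h : TendstoBoundary B a ξ) (h' : TendstoBoundary B a η) : ξ = η := by
  apply Subtype.ext
  funext n
  obtain ⟨K, hK⟩ := h (n + 1)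
  obtain ⟨K', hK'⟩ := h' (n + 1)
  have e := (List.prefix_of_prefix_length_le (hK _ (le_max_left K K'))
    (hK' _ (le_max_right K K')) (by simp)).eq_of_length (by simp)
  exact congrFun (List.ofFn_injective e) (Fin.last n)

lemma TendstoBoundary.letter_mul (x : B × Bool) {a : ℕ → FreeGroup B} {ξ : Boundary B}
    (h : TendstoBoundary B a ξ) :
    TendstoBoundary B (fun k => FreeGroup.mk [x] * a k) (consB B x ξ) := by
  obtain ⟨K₀, hK₀⟩ := h.head?
  intro m
  obtain ⟨K, hK⟩ := h (m + 1)
  obtain ⟨K', hK'⟩ := h (m - 1)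
  refine ⟨max K₀ (max K K'), fun k hk => ?_⟩
  have hhead := hK₀ k (by omega)
  have hpre := hK k (by omega)
  have hpre' := hK' k (by omega)
  by_cases hx : ξ.1 0 = invLetter x
  · rw [hx] at hhead
    rw [toWord_eq_cons_of_head?_eq hhead, List.ofFn_succ, List.cons_prefix_cons] at hpre
    simpa [consB_of_eq hx] using hpre.2
  · have hne : (a k).toWord.head? ≠ some (invLetter x) := by
      rw [hhead]
      simpa using hx
    rw [toWord_letter_mul_of_head?_ne hne]
    cases m with
    | zero => simp
    | succ m =>
      rw [List.ofFn_succ, List.cons_prefix_cons]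
      refine ⟨consB_of_ne_zero hx, ?_⟩
      simp only [Fin.val_succ, consB_of_ne_succ hx]
      exact hpre'

variable {r : ℕ} {w : Fin r → FreeGroup B}

lemma IsLine.symm {ξ η : Boundary B} (h : IsLine B w ξ η) : IsLine B w η ξ := by
  obtain ⟨g, i, h | h⟩ := h
  · exact ⟨g, i, Or.inr h⟩
  · exact ⟨g, i, Or.inl h⟩

lemma IsLine.consB (x : B × Bool) {ξ η : Boundary B} (h : IsLine B w ξ η) :
    IsLine B w (consB B x ξ) (consB B x η) := by
  obtain ⟨g, i, h⟩ := h
  refine ⟨FreeGroup.mk [x] * g, i, ?_⟩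
  simp only [mul_assoc]
  exact h.imp (fun h => ⟨h.1.letter_mul x, h.2.letter_mul x⟩)
    (fun h => ⟨h.1.letter_mul x, h.2.letter_mul x⟩)

lemma IsLine.actB (g : FreeGroup B) {ξ η : Boundary B} (h : IsLine B w ξ η) :
    IsLine B w (actB B g ξ) (actB B g η) := by
  unfold DecompPaper.actB
  induction g.toWord with
  | nil => exact h
  | cons x L ih => exact ih.consB x

lemma exists_int_change {P : ℤ → Prop} {a b : ℤ} (ha : P a) (hb : ¬P b) :
    ∃ n, ¬(P n ↔ P (n + 1)) := by
  by_contra! h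
  have hall (n : ℤ) : P n ↔ P 0 := by
    induction n with
    | zero => rfl
    | succ n ih => rw [← h, ih]
    | pred n ih => rw [h, sub_add_cancel, ih]
  exact hb ((hall b).2 ((hall a).1 ha))

/-- If the axis of a conjugate of `u` crosses between the cylinder of `x` and its
complement, then it is the translate of the axis of `u` by the inverse of a prefix of `u`. -/
lemma exists_prefix_tendsto {g u : FreeGroup B} {ξ η : Boundary B}
    (hξ : TendstoBoundary B (fun k => g * u ^ k) ξ)
    (hη : TendstoBoundary B (fun k => g * u⁻¹ ^ k) η) (hne : ξ.1 0 ≠ η.1 0) :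
    ∃ p ∈ u.toWord.inits, TendstoBoundary B (fun k => (FreeGroup.mk p)⁻¹ * u ^ k) ξ := by
  obtain ⟨K, hK⟩ := hξ.head?
  obtain ⟨K', hK'⟩ := hη.head?
  obtain ⟨n, hn⟩ := exists_int_change
    (P := fun n : ℤ => (g * u ^ n).toWord.head? = some (ξ.1 0)) (a := K) (b := -K')
    (by simpa using hK K le_rfl)
    (by
      have := hK' K' le_rfl
      simp only [zpow_neg, zpow_natCast]
      rw [inv_pow] at this
      rw [this]
      simpa using hne.symm)
  have hstep : g * u ^ (n + 1) = g * u ^ n * FreeGroup.mk u.toWord := by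
    rw [FreeGroup.mk_toWord, zpow_add_one, mul_assoc]
  rw [hstep] at hn
  obtain ⟨p, hp, e⟩ := exists_prefix_mul_eq_one _ _ hn
  refine ⟨p, hp, fun m => ?_⟩
  obtain ⟨N, hN⟩ := hξ m
  refine ⟨N + n.natAbs, fun k hk => ?_⟩
  obtain ⟨j, hj⟩ : ∃ j : ℕ, (j : ℤ) = k + n := ⟨(k + n).toNat, by omega⟩
  have hgj : (FreeGroup.mk p)⁻¹ * u ^ k = g * u ^ j := by
    rw [← eq_inv_of_mul_eq_one_left e, ← zpow_natCast, ← zpow_natCast, hj, mul_assoc,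
      ← zpow_add, add_comm]
  show _ <+: ((FreeGroup.mk p)⁻¹ * u ^ k).toWord
  rw [hgj]
  exact hN j (by omega)

/-- Only finitely many lines cross between the cylinder of `x` and its complement. -/
lemma finite_crossing (w : Fin r → FreeGroup B) (x : B × Bool) :
    {ξ : Boundary B | ξ.1 0 = x ∧ ∃ η, IsLine B w ξ η ∧ η.1 0 ≠ x}.Finite := by
  have hfin (u : FreeGroup B) : {ξ : Boundary B | ∃ p ∈ u.toWord.inits,
      TendstoBoundary B (fun k => (FreeGroup.mk p)⁻¹ * u ^ k) ξ}.Finite := by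
    have : {ξ : Boundary B | ∃ p ∈ u.toWord.inits,
        TendstoBoundary B (fun k => (FreeGroup.mk p)⁻¹ * u ^ k) ξ}
        = ⋃ p ∈ {p | p ∈ u.toWord.inits},
          {ξ | TendstoBoundary B (fun k => (FreeGroup.mk p)⁻¹ * u ^ k) ξ} := by
      ext ξ; simp
    rw [this]
    refine Set.Finite.biUnion (List.finite_toSet _) fun p _ => ?_
    exact Set.Subsingleton.finite fun ξ hξ η hη => hξ.unique hη
  refine (Set.finite_iUnion fun i : Fin r => (hfin (w i)).union (hfin (w i)⁻¹)).subset ?_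
  rintro ξ ⟨hx, η, ⟨g, i, h | h⟩, hη⟩
  · exact Set.mem_iUnion.2
      ⟨i, Or.inl (exists_prefix_tendsto h.1 h.2 fun e => hη (e ▸ hx))⟩
  · refine Set.mem_iUnion.2 ⟨i, Or.inr (exists_prefix_tendsto h.2 ?_ fun e => hη (e ▸ hx))⟩
    simpa only [inv_inv] using h.1

end Lines

section LocallyConstant

variable (B : Type)

/-- The functions on the boundary depending only on the first `k` letters. -/
def depthSubmodule (k : ℕ) : Submodule ℤ (Boundary B → ℤ) where
  carrier := {f | ∀ ξ η, (∀ i < k, ξ.1 i = η.1 i) → f ξ = f η}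
  add_mem' hf hg ξ η h := by simp only [Pi.add_apply, hf ξ η h, hg ξ η h]
  zero_mem' _ _ _ := rfl
  smul_mem' c f hf ξ η h := by simp only [Pi.smul_apply, hf ξ η h]

variable {B}

lemma depthSubmodule_mono {k l : ℕ} (hkl : k ≤ l) :
    depthSubmodule B k ≤ depthSubmodule B l :=
  fun _ hf ξ η h => hf ξ η fun i hi => h i (hi.trans_le hkl)

instance : DiscreteTopology (B × Bool) := ⟨rfl⟩

lemma continuous_of_mem_depthSubmodule {k : ℕ} {f : Boundary B → ℤ}
    (hf : f ∈ depthSubmodule B k) : Continuous f := by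
  refine IsLocallyConstant.continuous ((IsLocallyConstant.iff_exists_open f).2 fun ξ => ?_)
  refine ⟨⋂ i ∈ Finset.range k, {η | η.1 i = ξ.1 i}, ?_, by simp, fun η hη => ?_⟩
  · refine isOpen_biInter_finset fun i _ => ?_
    have hc : Continuous fun η : Boundary B => η.1 i :=
      (continuous_apply i).comp continuous_subtype_val
    exact (isOpen_discrete {ξ.1 i}).preimage hc
  · exact hf η ξ fun i hi => by simpa using Set.mem_iInter₂.1 hη i (Finset.mem_range.2 hi)

lemma compactSpace_boundary [Finite B] : CompactSpace (Boundary B) := by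
  have hset : {s : ℕ → B × Bool | ∀ k, s (k + 1) ≠ ((s k).1, !(s k).2)}
      = ⋂ k, (fun s => (s k, s (k + 1))) ⁻¹' {p | p.2 ≠ (p.1.1, !p.1.2)} := by
    ext s; simp
  have hclosed : IsClosed {s : ℕ → B × Bool | ∀ k, s (k + 1) ≠ ((s k).1, !(s k).2)} := by
    rw [hset]
    exact isClosed_iInter fun k => (isClosed_discrete _).preimage
      ((continuous_apply k).prodMk (continuous_apply (k + 1)))
  exact isCompact_iff_compactSpace.1 hclosed.isCompact

lemma exists_mem_depthSubmodule [Finite B] {f : Boundary B → ℤ} (hf : Continuous f) :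
    ∃ k, f ∈ depthSubmodule B k := by
  have := compactSpace_boundary (B := B)
  let C (k : ℕ) : Set (Boundary B × Boundary B) :=
    {p | f p.1 ≠ f p.2} ∩ ⋂ i ∈ Finset.range k, {p | p.1.1 i = p.2.1 i}
  have hclosed (k : ℕ) : IsClosed (C k) := by
    refine IsClosed.inter ?_ (isClosed_biInter fun i _ => ?_)
    · exact (isClosed_discrete {q : ℤ × ℤ | q.1 ≠ q.2}).preimage
        ((hf.comp continuous_fst).prodMk (hf.comp continuous_snd))
    · have hc : Continuous fun ξ : Boundary B => ξ.1 i :=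
        (continuous_apply i).comp continuous_subtype_val
      exact isClosed_eq (hc.comp continuous_fst) (hc.comp continuous_snd)
  by_contra! hdepth
  have hne (k : ℕ) : (C k).Nonempty := by
    by_contra hempty
    refine hdepth k fun ξ η h => by_contra fun hfne => hempty ⟨(ξ, η), hfne, ?_⟩
    simpa using h
  obtain ⟨⟨ξ, η⟩, hp⟩ := IsCompact.nonempty_iInter_of_sequence_nonempty_isCompact_isClosed C
    (fun k => Set.inter_subset_inter_right _
      (Set.biInter_subset_biInter_left (by simp)))
    hne (hclosed 0).isCompact hclosed
  rw [Set.mem_iInter] at hp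
  refine (hp 0).1 (congrArg f (Subtype.ext (funext fun i => ?_)))
  exact Set.mem_iInter₂.1 (hp (i + 1)).2 i (by simp)

lemma depthSubmodule_fg [Finite B] (k : ℕ) (N : Submodule ℤ (Boundary B → ℤ))
    (hN : N ≤ depthSubmodule B k) : N.FG := by
  let φ : ((Fin k → B × Bool) → ℤ) →ₗ[ℤ] (Boundary B → ℤ) :=
    LinearMap.funLeft ℤ ℤ fun ξ i => ξ.1 i
  have hle : N ≤ LinearMap.range φ := by
    intro f hf
    refine ⟨Function.extend (fun (ξ : Boundary B) (i : Fin k) => ξ.1 i) f 0, ?_⟩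
    funext ξ
    have hfac : f.FactorsThrough fun (ξ : Boundary B) (i : Fin k) => ξ.1 i :=
      fun ξ η h => hN hf ξ η fun i hi => congrFun h ⟨i, hi⟩
    exact hfac.extend_apply 0 ξ
  have := isNoetherian_of_le hle
  exact (isNoetherian_submodule.1 this) N le_rfl

end LocallyConstant

section Generation

variable {B : Type} [DecidableEq B] {r : ℕ}

/-- The functions on the boundary taking equal values at the two endpoints of each line that
lies in the region `S` of the boundary. -/
def invSubmodule (w : Fin r → FreeGroup B) (S : Set (Boundary B)) :
    Submodule ℤ (Boundary B → ℤ) where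
  carrier := {f | ∀ ξ ∈ S, ∀ η ∈ S, IsLine B w ξ η → f ξ = f η}
  add_mem' hf hg ξ hξ η hη h := by
    simp only [Pi.add_apply, hf ξ hξ η hη h, hg ξ hξ η hη h]
  zero_mem' _ _ _ _ _ := rfl
  smul_mem' c f hf ξ hξ η hη h := by simp only [Pi.smul_apply, hf ξ hξ η hη h]

/-- The functions on the boundary vanishing off the cylinder of the letter `x`. -/
def cylSubmodule (x : B × Bool) : Submodule ℤ (Boundary B → ℤ) where
  carrier := {f | ∀ ξ, ξ.1 0 ≠ x → f ξ = 0}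
  add_mem' hf hg ξ h := by simp only [Pi.add_apply, hf ξ h, hg ξ h, add_zero]
  zero_mem' _ _ := rfl
  smul_mem' c f hf ξ h := by simp only [Pi.smul_apply, hf ξ h, smul_zero]

/-- The restriction of a function on the boundary to the cylinder of `y`, extended by zero. -/
def cylPart (f : Boundary B → ℤ) (y : B × Bool) : Boundary B → ℤ :=
  fun ξ => if ξ.1 0 = y then f ξ else 0

lemma sum_cylPart [Fintype B] (f : Boundary B → ℤ) : ∑ y, cylPart f y = f := by
  funext ξ
  simp [cylPart, Finset.sum_apply]

lemma cylPart_mem_cylSubmodule (f : Boundary B → ℤ) (y : B × Bool) :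
    cylPart f y ∈ cylSubmodule y :=
  fun _ h => if_neg h

lemma cylPart_mem_depthSubmodule {f : Boundary B → ℤ} {k : ℕ} (hk : 1 ≤ k)
    (hf : f ∈ depthSubmodule B k) (y : B × Bool) : cylPart f y ∈ depthSubmodule B k := by
  intro ξ η h
  simp only [cylPart, h 0 hk, hf ξ η h]

lemma cylPart_mem_invSubmodule {w : Fin r → FreeGroup B} {f : Boundary B → ℤ}
    (hf : f ∈ invSubmodule w Set.univ) (y : B × Bool) :
    cylPart f y ∈ invSubmodule w {ξ | ξ.1 0 = y} := by
  intro ξ hξ η hη h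
  simp only [cylPart, if_pos hξ.out, if_pos hη.out, hf ξ trivial η trivial h]

lemma comp_actB_mem_invSubmodule {w : Fin r → FreeGroup B} {f : Boundary B → ℤ}
    (hf : f ∈ invSubmodule w Set.univ) (g : FreeGroup B) :
    f ∘ actB B g ∈ invSubmodule w Set.univ :=
  fun _ _ _ _ h => hf _ trivial _ trivial (h.actB g)

/-- The functions of bounded depth on the cylinder of `x`, invariant under the lines inside
this cylinder, realize all boundary values on the lines leaving the cylinder. -/
lemma exists_depth_crossing_values (w : Fin r → FreeGroup B) (x : B × Bool) :
    ∃ R, ∀ k, ∀ f ∈ depthSubmodule B k ⊓ cylSubmodule x ⊓ invSubmodule w {ξ | ξ.1 0 = x},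
      ∃ u ∈ depthSubmodule B R ⊓ cylSubmodule x ⊓ invSubmodule w {ξ | ξ.1 0 = x},
        ∀ ξ η, ξ.1 0 = x → IsLine B w ξ η → η.1 0 ≠ x → f ξ = u ξ := by
  let E : Set (Boundary B) := {ξ | ξ.1 0 = x ∧ ∃ η, IsLine B w ξ η ∧ η.1 0 ≠ x}
  have : Finite E := finite_crossing w x
  let ρ : (Boundary B → ℤ) →ₗ[ℤ] (E → ℤ) := LinearMap.funLeft ℤ ℤ Subtype.val
  let M : ℕ →o Submodule ℤ (E → ℤ) :=
    { toFun := fun k => Submodule.map ρ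
        (depthSubmodule B k ⊓ cylSubmodule x ⊓ invSubmodule w {ξ | ξ.1 0 = x})
      monotone' := fun k l hkl => Submodule.map_mono
        (inf_le_inf_right _ (inf_le_inf_right _ (depthSubmodule_mono hkl))) }
  obtain ⟨R, hR⟩ := monotone_stabilizes_iff_noetherian.2 inferInstance M
  refine ⟨R, fun k f hf => ?_⟩
  have hmem : ρ f ∈ M R := by
    rw [hR (max k R) (le_max_right _ _)]
    exact M.monotone (le_max_left k R) (Submodule.mem_map_of_mem hf)
  obtain ⟨u, hu, hρ⟩ := hmem
  exact ⟨u, hu, fun ξ η hξ hl hη => (congrFun hρ ⟨ξ, hξ, η, hl, hη⟩).symm⟩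

lemma exists_uniform_depth [Fintype B] (w : Fin r → FreeGroup B) :
    ∃ R, 1 ≤ R ∧ ∀ x k,
      ∀ f ∈ depthSubmodule B k ⊓ cylSubmodule x ⊓ invSubmodule w {ξ | ξ.1 0 = x},
      ∃ u ∈ depthSubmodule B R ⊓ cylSubmodule x ⊓ invSubmodule w {ξ | ξ.1 0 = x},
        ∀ ξ η, ξ.1 0 = x → IsLine B w ξ η → η.1 0 ≠ x → f ξ = u ξ := by
  choose R hR using exists_depth_crossing_values (B := B) w
  refine ⟨Finset.univ.sup R + 1, by omega, fun x k f hf => ?_⟩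
  obtain ⟨u, hu, h⟩ := hR x k f hf
  have hle : R x ≤ Finset.univ.sup R + 1 :=
    (Finset.le_sup (Finset.mem_univ x)).trans (Nat.le_succ _)
  exact ⟨u, ⟨⟨depthSubmodule_mono hle hu.1.1, hu.1.2⟩, hu.2⟩, h⟩

/-- A function on the cylinder of `x` that is invariant under the lines inside the cylinder
and vanishes on the lines leaving it is invariant. -/
lemma mem_invSubmodule_univ {w : Fin r → FreeGroup B} {x : B × Bool} {f : Boundary B → ℤ}
    (hc : f ∈ cylSubmodule x) (hi : f ∈ invSubmodule w {ξ | ξ.1 0 = x})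
    (h0 : ∀ ξ η, ξ.1 0 = x → IsLine B w ξ η → η.1 0 ≠ x → f ξ = 0) :
    f ∈ invSubmodule w Set.univ := by
  intro ξ _ η _ h
  by_cases hξ : ξ.1 0 = x <;> by_cases hη : η.1 0 = x
  · exact hi ξ hξ η hη h
  · rw [h0 ξ η hξ h hη, hc η hη]
  · rw [h0 η ξ hη h.symm hξ, hc ξ hξ]
  · rw [hc ξ hξ, hc η hη]

/-- There is a depth `R` such that every translation-invariant module of functions containing
the invariant functions of depth `R` contains all locally constant invariant functions. -/
lemma exists_generating_depth [Fintype B] (w : Fin r → FreeGroup B) :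
    ∃ R, ∀ S : Submodule ℤ (Boundary B → ℤ), (∀ f ∈ S, ∀ g, f ∘ actB B g ∈ S) →
      depthSubmodule B R ⊓ invSubmodule w Set.univ ≤ S →
      ∀ k, depthSubmodule B k ⊓ invSubmodule w Set.univ ≤ S := by
  obtain ⟨R, hR1, hR⟩ := exists_uniform_depth (B := B) w
  refine ⟨R, fun S hS hRS => ?_⟩
  have step (k : ℕ) (hk : R ≤ k)
      (hcyl : ∀ x, depthSubmodule B k ⊓ cylSubmodule x ⊓ invSubmodule w Set.univ ≤ S)
      (f : Boundary B → ℤ) (hf : f ∈ invSubmodule w Set.univ)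
      (hpart : ∀ y, cylPart f y ∈ depthSubmodule B k) : f ∈ S := by
    have hex (y) := hR y k (cylPart f y)
      ⟨⟨hpart y, cylPart_mem_cylSubmodule f y⟩, cylPart_mem_invSubmodule hf y⟩
    choose u hu hfu using hex
    have hdiff (y) : cylPart f y - u y ∈
        depthSubmodule B k ⊓ cylSubmodule y ⊓ invSubmodule w Set.univ := by
      have hc := sub_mem (cylPart_mem_cylSubmodule f y) (hu y).1.2
      refine ⟨⟨sub_mem (hpart y) (depthSubmodule_mono hk (hu y).1.1), hc⟩, ?_⟩
      refine mem_invSubmodule_univ hc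
        (sub_mem (cylPart_mem_invSubmodule hf y) (hu y).2) fun ξ η hξ h hη => ?_
      rw [Pi.sub_apply, hfu y ξ η hξ h hη, sub_self]
    have hsum : f = ∑ y, (cylPart f y - u y) + ∑ y, u y := by
      rw [Finset.sum_sub_distrib, sum_cylPart, sub_add_cancel]
    have hu_inv : ∑ y, u y ∈ invSubmodule w Set.univ := by
      have : ∑ y, u y = f - ∑ y, (cylPart f y - u y) := eq_sub_of_add_eq' hsum.symm
      rw [this]
      exact sub_mem hf (sum_mem fun y _ => (hdiff y).2)
    rw [hsum]
    exact add_mem (sum_mem fun y _ => hcyl y (hdiff y))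
      (hRS ⟨sum_mem fun y _ => (hu y).1.1, hu_inv⟩)
  have hcyl (k : ℕ) (hk : R ≤ k) :
      ∀ x, depthSubmodule B k ⊓ cylSubmodule x ⊓ invSubmodule w Set.univ ≤ S := by
    induction k, hk using Nat.le_induction with
    | base => exact fun x f hf => hRS ⟨hf.1.1, hf.2⟩
    | succ k hk ih =>
      rintro x f ⟨⟨hd, hc⟩, hi⟩
      have hmem : f ∘ actB B (FreeGroup.mk [x]) ∈ S := by
        refine step k hk ih _ (comp_actB_mem_invSubmodule hi _) fun y ξ η h => ?_
        have h0 : ξ.1 0 = η.1 0 := h 0 (by omega)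
        simp only [cylPart, h0, Function.comp_apply, actB_letter]
        split_ifs with hy
        · by_cases hx : η.1 0 = invLetter x
          · have vanish (ζ : Boundary B) (hζ : ζ.1 0 = invLetter x) :
                f (consB B x ζ) = 0 := by
              refine hc _ ?_
              rw [consB_of_eq hζ]
              have := ζ.2 0
              rw [hζ] at this
              simpa [invLetter] using this
            rw [vanish ξ (h0.trans hx), vanish η hx]
          · refine hd _ _ fun i hi => ?_
            cases i with
            | zero => rw [consB_of_ne_zero hx, consB_of_ne_zero (h0 ▸ hx)]
            | succ i =>
              rw [consB_of_ne_succ hx, consB_of_ne_succ (h0 ▸ hx), h i (by omega)]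
        · rfl
      have hback := hS _ hmem (FreeGroup.mk [x])⁻¹
      have hid : (f ∘ actB B (FreeGroup.mk [x])) ∘ actB B (FreeGroup.mk [x])⁻¹ = f := by
        funext ξ
        simp only [Function.comp_apply, ← actB_mul, mul_inv_cancel, actB_one]
      rwa [hid] at hback
  rintro k f ⟨hd, hi⟩
  have hd' := depthSubmodule_mono (le_max_left k R) hd
  exact step (max k R) (le_max_right _ _) (hcyl _ (le_max_right _ _)) f hi
    fun y => cylPart_mem_depthSubmodule (hR1.trans (le_max_right _ _)) hd' y

lemma actD_qmap (w : Fin r → FreeGroup B) (g : FreeGroup B) (ξ : Boundary B) :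
    actD B w g (qmap B w ξ) = qmap B w (actB B g ξ) := by
  have h := congrArg (Quot.map (actB B g) fun _ _ h => IsLine.actB (w := w) g h)
    (Quot.out_eq (qmap B w ξ))
  exact h

end Generation

end DecompPaper

open DecompPaper
/-- `C(D, ℤ)` is finitely generated as a right `ℤ[F]`-module: there
are finitely many continuous `σ j : D → ℤ` such that every continuous `τ : D → ℤ` is a
finite `ℤ`-linear combination of `F`-translates `σ j · g` (where
`(σ · g)(x) = σ (g · x)`). -/
theorem zeroth_cohomology_finitely_generated
    (B : Type) [Fintype B] [DecidableEq B] (hB : 2 ≤ Fintype.card B)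
    (r : ℕ) (w : Fin r → FreeGroup B) (hw : ∀ i, w i ≠ 1) (hmal : Malnormal B w) :
    ∃ (k : ℕ) (σ : Fin k → DSpace B w → ℤ),
      (∀ j, Continuous (σ j)) ∧
      ∀ τ : DSpace B w → ℤ, Continuous τ →
        ∃ (m : ℕ) (c : Fin m → ℤ) (j : Fin m → Fin k) (g : Fin m → FreeGroup B),
          τ = fun d => ∑ i, c i * σ (j i) (actD B w (g i) d) := by
  obtain ⟨R, hR⟩ := exists_generating_depth (B := B) w
  obtain ⟨k, s, hs⟩ := Submodule.fg_iff_exists_fin_generating_family.1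
    (depthSubmodule_fg R (depthSubmodule B R ⊓ invSubmodule w Set.univ) inf_le_left)
  have hsmem (j : Fin k) : s j ∈ depthSubmodule B R ⊓ invSubmodule w Set.univ :=
    hs ▸ Submodule.subset_span ⟨j, rfl⟩
  let σ (j : Fin k) : DSpace B w → ℤ :=
    Quot.lift (s j) fun ξ η h => (hsmem j).2 ξ trivial η trivial h
  let S : Submodule ℤ (Boundary B → ℤ) :=
    Submodule.span ℤ (Set.range fun p : Fin k × FreeGroup B => s p.1 ∘ actB B p.2)
  have hS : ∀ f ∈ S, ∀ g, f ∘ actB B g ∈ S := by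
    intro f hf g
    induction hf using Submodule.span_induction with
    | mem f hf =>
      obtain ⟨⟨j, h⟩, rfl⟩ := hf
      refine Submodule.subset_span ⟨(j, h * g), ?_⟩
      funext ξ
      simp only [Function.comp_apply, actB_mul]
    | zero => exact S.zero_mem
    | add f f' _ _ hf hf' => exact S.add_mem hf hf'
    | smul c f _ hf => exact S.smul_mem c hf
  have hbase : depthSubmodule B R ⊓ invSubmodule w Set.univ ≤ S := by
    rw [← hs, Submodule.span_le]
    rintro _ ⟨j, rfl⟩
    refine Submodule.subset_span ⟨(j, 1), ?_⟩
    funext ξ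
    simp only [Function.comp_apply, actB_one]
  refine ⟨k, σ, fun j => ?_, fun τ hτ => ?_⟩
  · exact continuous_quot_lift _ (continuous_of_mem_depthSubmodule (hsmem j).1)
  · obtain ⟨l, hl⟩ := exists_mem_depthSubmodule (hτ.comp continuous_quot_mk)
    have hmem : τ ∘ Quot.mk _ ∈ S :=
      hR S hS hbase l ⟨hl, fun ξ _ η _ h => congrArg τ (Quot.sound h)⟩
    obtain ⟨m, c, v, hv⟩ := Submodule.mem_span_set'.1 hmem
    choose p hp using fun i => (v i).2
    refine ⟨m, c, fun i => (p i).1, fun i => (p i).2, ?_⟩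
    funext d
    obtain ⟨ξ, rfl⟩ := Quot.exists_rep d
    have h := congrFun hv ξ
    rw [Function.comp_apply] at h
    rw [← h, Finset.sum_apply]
    refine Finset.sum_congr rfl fun i _ => ?_
    rw [Pi.smul_apply, smul_eq_mul, ← hp i]
    exact congrArg (c i * σ (p i).1 ·) (actD_qmap w (p i).2 ξ).symm
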